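/- Let G be a finite group and π : G → B a partial representation on a unital associative k-algebra B. Then: (1) for all subsets X, Y ⊆ G with e ∈ X and e ∈ Y, P_Y Γ_X = P_Y if X ∼ Y and P_Y Γ_X = 0 otherwise; (2) for all such X, Y, Γ_Y Γ_X = Γ_X if X ∼ Y and Γ_Y Γ_X = 0 otherwise; (3) if T is a set of subsets of G containing e which is a complete set of representatives for the equivalence relation ∼ on {X ⊆ G : e ∈ X}, then Σ_{X ∈ T} Γ_X = 1_B. -/

import Mathlib

open scoped Pointwise

/-- A partial representation of a group `G` on a unital (`k`-)algebra `B`. -/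
def IsPartialRep {G B : Type*} [Group G] [Monoid B] (π : G → B) : Prop :=
  π 1 = 1 ∧
  (∀ g h : G, π g * π h * π h⁻¹ = π (g * h) * π h⁻¹) ∧
  (∀ g h : G, π g⁻¹ * π g * π h = π g⁻¹ * π (g * h))

/-- The defining relations of the partial group algebra. -/
inductive ParRel (k G : Type*) [CommSemiring k] [Group G] :
    FreeAlgebra k G → FreeAlgebra k G → Prop
  | one : ParRel k G (FreeAlgebra.ι k (1 : G)) 1
  | pr2 (g h : G) : ParRel k G
      (FreeAlgebra.ι k g * FreeAlgebra.ι k h * FreeAlgebra.ι k h⁻¹)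
      (FreeAlgebra.ι k (g * h) * FreeAlgebra.ι k h⁻¹)
  | pr3 (g h : G) : ParRel k G
      (FreeAlgebra.ι k g⁻¹ * FreeAlgebra.ι k g * FreeAlgebra.ι k h)
      (FreeAlgebra.ι k g⁻¹ * FreeAlgebra.ι k (g * h))

/-- The partial group algebra `k_par G`. -/
abbrev ParAlg (k G : Type*) [CommSemiring k] [Group G] := RingQuot (ParRel k G)

/-- The generator `[g]` of the partial group algebra. -/
noncomputable def parGen (k : Type*) {G : Type*} [CommSemiring k] [Group G] (g : G) :
    ParAlg k G :=
  RingQuot.mkAlgHom k (ParRel k G) (FreeAlgebra.ι k g)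

/-- The idempotent `P_X = (∏_{r ∈ X} ε_r)·(∏_{s ∉ X} (1 - ε_s))`, where `ε_g = π(g)π(g⁻¹)`. -/
noncomputable def parP {G B : Type*} [Group G] [Fintype G] [DecidableEq G] [Ring B]
    (π : G → B) (X : Finset G) : B :=
  (X.toList.map fun r => π r * π r⁻¹).prod *
    (Xᶜ.toList.map fun s => 1 - π s * π s⁻¹).prod

/-- `Γ_X = Σ_{Y ∼ X} P_Y`, where `Y ∼ X` iff `Y = gX` for some `g ∈ G`. -/
noncomputable def parGamma {G B : Type*} [Group G] [Fintype G] [DecidableEq G] [Ring B]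
    (π : G → B) (X : Finset G) : B :=
  ∑ Y ∈ Finset.univ.filter (fun Y : Finset G => ∃ g : G, Y = g • X), parP π Y

/-- `P_X` for a family `e` of elements of a commutative ring. -/
def minterm {ι R : Type*} [Fintype ι] [DecidableEq ι] [CommRing R] (e : ι → R)
    (X : Finset ι) : R :=
  (∏ r ∈ X, e r) * ∏ s ∈ Xᶜ, (1 - e s)

section Minterm

variable {ι R : Type*} [Fintype ι] [DecidableEq ι] [CommRing R]

theorem sum_minterm (e : ι → R) : ∑ X, minterm e X = 1 := by
  have h := Finset.prod_add e (fun i => 1 - e i) Finset.univ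
  simp only [add_sub_cancel, Finset.prod_const_one, Finset.powerset_univ] at h
  exact h.symm

theorem minterm_mul_self {e : ι → R} (he : ∀ i, e i * e i = e i) (X : Finset ι) :
    minterm e X * minterm e X = minterm e X := by
  have h : ∀ i, (1 - e i) * (1 - e i) = 1 - e i := fun i => by linear_combination he i
  rw [minterm, mul_mul_mul_comm, ← Finset.prod_mul_distrib, ← Finset.prod_mul_distrib]
  simp only [he, h]

theorem mul_minterm_of_mem {e : ι → R} (he : ∀ i, e i * e i = e i) {X : Finset ι} {i : ι}
    (hi : i ∈ X) : e i * minterm e X = minterm e X := by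
  rw [minterm, ← Finset.mul_prod_erase X e hi, ← mul_assoc, ← mul_assoc, he]

theorem mul_minterm_of_notMem {e : ι → R} (he : ∀ i, e i * e i = e i) {X : Finset ι} {i : ι}
    (hi : i ∉ X) : e i * minterm e X = 0 := by
  rw [minterm, ← Finset.mul_prod_erase Xᶜ _ (Finset.mem_compl.2 hi)]
  linear_combination (-(∏ r ∈ X, e r) * ∏ s ∈ Xᶜ.erase i, (1 - e s)) * he i

theorem minterm_mul_of_ne {e : ι → R} (he : ∀ i, e i * e i = e i) {X Y : Finset ι}
    (h : X ≠ Y) : minterm e X * minterm e Y = 0 := by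
  obtain ⟨i, hi⟩ : ∃ i, ¬(i ∈ X ↔ i ∈ Y) := by
    by_contra! H
    exact h (Finset.ext H)
  by_cases hX : i ∈ X
  · have hY : i ∉ Y := by tauto
    rw [← mul_minterm_of_mem he hX, mul_right_comm, mul_minterm_of_notMem he hY, zero_mul]
  · have hY : i ∈ Y := by tauto
    rw [← mul_minterm_of_mem he hY, mul_left_comm, ← mul_assoc, mul_minterm_of_notMem he hX,
      zero_mul]

end Minterm

namespace IsPartialRep

universe u

variable {G : Type*} {B : Type u} [Group G]

section Monoid

variable [Monoid B] {π : G → B}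

theorem mul_inv_mul (hπ : IsPartialRep π) (g : G) : π g * π g⁻¹ * π g = π g := by
  have h := hπ.2.1 g g⁻¹
  rwa [inv_inv, mul_inv_cancel, hπ.1, one_mul] at h

theorem mul_eps (hπ : IsPartialRep π) (g h : G) :
    π g * (π h * π h⁻¹) = π (g * h) * π (g * h)⁻¹ * π g := by
  have h₃ := hπ.2.2 (g * h)⁻¹ g
  rw [inv_inv, mul_inv_rev, inv_mul_cancel_right] at h₃
  rw [← mul_assoc, hπ.2.1, mul_inv_rev, h₃]

theorem eps_mul_self (hπ : IsPartialRep π) (g : G) :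
    π g * π g⁻¹ * (π g * π g⁻¹) = π g * π g⁻¹ := by
  rw [← mul_assoc, hπ.mul_inv_mul]

theorem eps_comm (hπ : IsPartialRep π) (g h : G) :
    π g * π g⁻¹ * (π h * π h⁻¹) = π h * π h⁻¹ * (π g * π g⁻¹) := by
  rw [mul_assoc, hπ.mul_eps, ← mul_assoc, hπ.mul_eps, mul_inv_cancel_left, mul_assoc]

end Monoid

variable [Fintype G] [DecidableEq G] [Ring B] {π : G → B}

open scoped IsMulCommutative in
theorem exists_parP_eq_map_minterm (hπ : IsPartialRep π) :
    ∃ (R : Type u) (_ : CommRing R) (f : R →+* B) (e : G → R), (∀ g, e g * e g = e g) ∧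
      e 1 = 1 ∧ ∀ X, parP π X = f (minterm e X) := by
  let S : Set B := Set.range fun g => π g * π g⁻¹
  have hS : ∀ x ∈ S, ∀ y ∈ S, x * y = y * x := by
    rintro _ ⟨g, rfl⟩ _ ⟨h, rfl⟩
    exact hπ.eps_comm g h
  have := Subring.isMulCommutative_closure hS
  refine ⟨Subring.closure S, inferInstance, (Subring.closure S).subtype,
    fun g => ⟨π g * π g⁻¹, Subring.subset_closure ⟨g, rfl⟩⟩,
    fun g => Subtype.ext (hπ.eps_mul_self g), Subtype.ext ?_, fun X => ?_⟩
  · change π 1 * π 1⁻¹ = 1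
    rw [inv_one, hπ.1, one_mul]
  · rw [minterm, map_mul, ← Finset.prod_map_toList, ← Finset.prod_map_toList, map_list_prod,
      map_list_prod, List.map_map, List.map_map]
    rfl

theorem parP_mul_parP (hπ : IsPartialRep π) (X Y : Finset G) :
    parP π X * parP π Y = if X = Y then parP π X else 0 := by
  obtain ⟨R, _, f, e, he, -, hP⟩ := hπ.exists_parP_eq_map_minterm
  rw [hP, hP, ← map_mul]
  split_ifs with h
  · rw [h, minterm_mul_self he]
  · rw [minterm_mul_of_ne he h, map_zero]

theorem sum_parP (hπ : IsPartialRep π) : ∑ X, parP π X = 1 := by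
  obtain ⟨R, _, f, e, -, -, hP⟩ := hπ.exists_parP_eq_map_minterm
  simp only [hP]
  rw [← map_sum, sum_minterm, map_one]

theorem parP_eq_zero (hπ : IsPartialRep π) {X : Finset G} (hX : (1 : G) ∉ X) :
    parP π X = 0 := by
  obtain ⟨R, _, f, e, he, h1, hP⟩ := hπ.exists_parP_eq_map_minterm
  rw [hP, ← one_mul (minterm e X), ← h1, mul_minterm_of_notMem he hX, map_zero]

theorem parP_mul_parGamma (hπ : IsPartialRep π) (X Y : Finset G) :
    parP π Y * parGamma π X = if ∃ g : G, Y = g • X then parP π Y else 0 := by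
  simp only [parGamma, Finset.mul_sum, hπ.parP_mul_parP, Finset.sum_ite_eq, Finset.mem_filter,
    Finset.mem_univ, true_and]

theorem parGamma_mul_parGamma (hπ : IsPartialRep π) (X Y : Finset G) :
    parGamma π Y * parGamma π X = if ∃ g : G, Y = g • X then parGamma π X else 0 := by
  rw [parGamma, Finset.sum_mul]
  simp only [hπ.parP_mul_parGamma]
  split_ifs with h
  · obtain ⟨g, rfl⟩ := h
    have hiff : ∀ Z : Finset G, (∃ a : G, Z = a • g • X) ↔ ∃ a : G, Z = a • X := fun Z =>
      ⟨fun ⟨a, ha⟩ => ⟨a * g, by rw [ha, mul_smul]⟩,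
        fun ⟨a, ha⟩ => ⟨a * g⁻¹, by rw [ha, mul_smul, inv_smul_smul]⟩⟩
    simp only [hiff]
    rw [parGamma]
    exact Finset.sum_congr rfl fun Z hZ => if_pos (Finset.mem_filter.1 hZ).2
  · refine Finset.sum_eq_zero fun Z hZ => if_neg ?_
    rintro ⟨b, hb⟩
    obtain ⟨a, ha⟩ := (Finset.mem_filter.1 hZ).2
    exact h ⟨a⁻¹ * b, by rw [mul_smul, ← hb, ha, inv_smul_smul]⟩

theorem sum_parGamma (hπ : IsPartialRep π) (T : Finset (Finset G))
    (hT : ∀ X : Finset G, (1 : G) ∈ X → ∃! Y, Y ∈ T ∧ ∃ g : G, Y = g • X) :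
    ∑ X ∈ T, parGamma π X = 1 := by
  simp only [parGamma, Finset.sum_filter]
  rw [Finset.sum_comm, ← hπ.sum_parP]
  refine Finset.sum_congr rfl fun Y _ => ?_
  by_cases hY : (1 : G) ∈ Y
  · obtain ⟨Z, ⟨hZT, g, hg⟩, huniq⟩ := hT Y hY
    rw [Finset.sum_eq_single_of_mem Z hZT, if_pos ⟨g⁻¹, by rw [hg, inv_smul_smul]⟩]
    intro X hXT hXZ
    refine if_neg ?_
    rintro ⟨a, ha⟩
    exact hXZ (huniq X ⟨hXT, a⁻¹, by rw [ha, inv_smul_smul]⟩)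
  · simp only [hπ.parP_eq_zero hY, ite_self, Finset.sum_const_zero]

end IsPartialRep

/-- For a finite group `G` and a partial representation `π : G → B`, where for
`X, Y ⊆ G` we write `X ∼ Y` iff `Y = gX` for some `g ∈ G`:
(1) `P_Y Γ_X = P_Y` if `X ∼ Y` and `0` otherwise;
(2) `Γ_Y Γ_X = Γ_X` if `X ∼ Y` and `0` otherwise;
(3) if `T` is a complete set of representatives for `∼` on `{X ⊆ G : e ∈ X}`,
then `Σ_{X ∈ T} Γ_X = 1`. -/
theorem parGamma_props
    (k : Type*) [Field k] {G : Type*} [Group G] [Fintype G] [DecidableEq G]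
    {B : Type*} [Ring B] [Algebra k B]
    (π : G → B) (hπ : IsPartialRep π) :
    (∀ X Y : Finset G, (1 : G) ∈ X → (1 : G) ∈ Y →
      parP π Y * parGamma π X = if ∃ g : G, Y = g • X then parP π Y else 0) ∧
    (∀ X Y : Finset G, (1 : G) ∈ X → (1 : G) ∈ Y →
      parGamma π Y * parGamma π X = if ∃ g : G, Y = g • X then parGamma π X else 0) ∧
    (∀ T : Finset (Finset G), (∀ X ∈ T, (1 : G) ∈ X) →
      (∀ X : Finset G, (1 : G) ∈ X → ∃! Y, Y ∈ T ∧ ∃ g : G, Y = g • X) →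
      ∑ X ∈ T, parGamma π X = 1) := by
  exact ⟨fun X Y _ _ => hπ.parP_mul_parGamma X Y, fun X Y _ _ => hπ.parGamma_mul_parGamma X Y,
    fun T _ hT => hπ.sum_parGamma T hT⟩
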